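/- Let A be a commutative noetherian ring, 𝔟 ⊆ 𝔞 ideals of A, M an A-module, and n a non-negative integer. If Ext_A^j(A/𝔞, Ext_A^i(A/𝔟, M)) is finitely generated for all i ≤ n and all j ≤ n, then Ext_A^i(A/𝔞, M) is finitely generated for all i ≤ n. -/

import Mathlib

open CategoryTheory Limits

noncomputable section

variable {A : Type} [CommRing A]

/-- `Ext_A^i(A/𝔞, M)` as an `A`-module. -/
abbrev extQuot (𝔞 : Ideal A) (M : Type) [AddCommGroup M] [Module A M] (i : ℕ) : Type :=
  ↥(((_root_.Ext A (ModuleCat A) i).obj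
    (Opposite.op (ModuleCat.of A (A ⧸ 𝔞)))).obj (ModuleCat.of A M))


section bridge
variable {R : Type} [CommRing R] {X : ModuleCat.{0} R} (P : ProjectiveResolution X) (Y : ModuleCat.{0} R)

lemma extMk_smul' {n : ℕ} (r : R) (f : P.complex.X n ⟶ Y) (m : ℕ) (hm : n + 1 = m)
    (hf : P.complex.d m n ≫ f = 0) :
    r • P.extMk f m hm hf = P.extMk (r • f) m hm (by simp [hf]) := by
  rw [Abelian.Ext.smul_eq_comp_mk₀, P.extMk_comp_mk₀]
  congr 1

lemma extMk_eq_zero_zero (f : P.complex.X 0 ⟶ Y) (m : ℕ) (hm : 0 + 1 = m)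
    (hf : P.complex.d m 0 ≫ f = 0) (h : P.extMk f m hm hf = 0) : f = 0 := by
  rw [← P.extEquivCohomologyClass.apply_eq_iff_eq,
    P.extEquivCohomologyClass_extMk, P.extEquivCohomologyClass_zero,
    CochainComplex.HomComplex.CohomologyClass.mk_eq_zero_iff] at h
  rw [CochainComplex.HomComplex.Cocycle.toSingleMk_mem_coboundaries_iff _ _ _ _ _ 1 (by simp)] at h
  obtain ⟨g, hg⟩ := h
  have h0 : g = 0 := (CochainComplex.isZero_of_isStrictlyLE P.cochainComplex 0 1).eq_of_src _ _
  rw [h0, comp_zero] at hg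
  rw [← cancel_epi (P.cochainComplexXIso (-(0:ℕ)) 0 rfl).hom, ← hg, comp_zero]

def cocycleToExt (n p : ℕ) :
    LinearMap.ker (((P.complex.linearYonedaObj R Y).sc' p n (n+1)).g.hom) →ₗ[R]
      Abelian.Ext X Y n where
  toFun f := P.extMk (show P.complex.X n ⟶ Y from f.1) (n+1) rfl f.2
  map_add' f g := (P.add_extMk _ _ _ _ f.2 g.2).symm
  map_smul' r f := (extMk_smul' P Y r _ _ _ f.2).symm

lemma cocycleToExt_surj (n p : ℕ) : Function.Surjective (cocycleToExt P Y n p) := by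
  intro e
  obtain ⟨f, hf, rfl⟩ := P.extMk_surjective e (n+1) rfl
  exact ⟨⟨f, hf⟩, rfl⟩

lemma cocycleToExt_ker (n p : ℕ) (hp : (ComplexShape.up ℕ).prev n = p) :
    LinearMap.range (((P.complex.linearYonedaObj R Y).sc' p n (n+1)).moduleCatToCycles) =
      LinearMap.ker (cocycleToExt P Y n p) := by
  ext f
  rw [LinearMap.mem_range, LinearMap.mem_ker]
  cases n with
  | zero =>
    have hp0 : p = 0 := by simpa using hp.symm
    subst hp0
    constructor
    · rintro ⟨g, rfl⟩
      have : ((P.complex.linearYonedaObj R Y).sc' 0 0 (0+1)).f = 0 :=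
        (P.complex.linearYonedaObj R Y).shape _ _ (by simp)
      have h2 : ((P.complex.linearYonedaObj R Y).sc' 0 0 (0+1)).moduleCatToCycles g = 0 := by
        apply Subtype.ext
        change ((P.complex.linearYonedaObj R Y).sc' 0 0 (0+1)).f g = 0
        rw [this]; rfl
      exact (congrArg (cocycleToExt P Y 0 0) h2).trans (map_zero _)
    · intro h
      have := extMk_eq_zero_zero P Y _ (0+1) rfl f.2 h
      exact ⟨0, by rw [map_zero]; exact Subtype.ext this.symm⟩
  | succ q =>
    have hp0 : p = q := by simpa using hp.symm
    subst hp0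
    constructor
    · rintro ⟨g, rfl⟩
      exact (P.extMk_eq_zero_iff _ (p+1+1) rfl (((P.complex.linearYonedaObj R Y).sc' p (p+1) (p+1+1)).moduleCatToCycles g).2 p rfl).2 ⟨g, rfl⟩
    · intro h
      obtain ⟨g, hg⟩ := (P.extMk_eq_zero_iff _ (p+1+1) rfl f.2 p rfl).1 h
      exact ⟨g, Subtype.ext hg⟩

def extBridge (X Y : ModuleCat.{0} R) (n : ℕ) :
    ((((_root_.Ext R (ModuleCat R) n).obj (Opposite.op X)).obj Y : ModuleCat R) : Type) ≃ₗ[R]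
      Abelian.Ext X Y n :=
  let P := projectiveResolution X
  ((P.isoExt n Y) ≪≫
    ((P.complex.linearYonedaObj R Y).homologyIsoSc' ((ComplexShape.up ℕ).prev n) n (n+1) rfl
      (by simp)) ≪≫
    ShortComplex.moduleCatHomologyIso _).toLinearEquiv ≪≫ₗ
    (Submodule.quotEquivOfEq _ _ (cocycleToExt_ker P Y n _ rfl)) ≪≫ₗ
    (LinearMap.quotKerEquivOfSurjective _ (cocycleToExt_surj P Y n _))

end bridge

section main
set_option linter.unusedSectionVars false
variable {R : Type} [CommRing R] [IsNoetherianRing R]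

/-- `Ext^j(X, N)` for `N` unbundled. -/
abbrev F (X : ModuleCat.{0} R) (j : ℕ) (N : Type) [AddCommGroup N] [Module R N] : Type :=
  Abelian.Ext X (ModuleCat.of R N) j

def Fmap (X : ModuleCat.{0} R) (j : ℕ) {N N' : Type} [AddCommGroup N] [Module R N]
    [AddCommGroup N'] [Module R N'] (f : N →ₗ[R] N') : F X j N →ₗ[R] F X j N' :=
  (Abelian.Ext.mk₀ (ModuleCat.ofHom f)).postcompOfLinear R X (add_zero j)

variable (X : ModuleCat.{0} R) {N N' N'' : Type} [AddCommGroup N] [Module R N]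
    [AddCommGroup N'] [Module R N'] [AddCommGroup N''] [Module R N'']

lemma Fmap_apply (j : ℕ) (f : N →ₗ[R] N') (e : F X j N) :
    Fmap X j f e = e.comp (Abelian.Ext.mk₀ (ModuleCat.ofHom f)) (add_zero j) := rfl

lemma Fmap_comp (j : ℕ) (f : N →ₗ[R] N') (g : N' →ₗ[R] N'') :
    Fmap X j (g ∘ₗ f) = Fmap X j g ∘ₗ Fmap X j f := by
  ext e
  simp [Fmap_apply, ModuleCat.ofHom_comp]

lemma Fmap_id (j : ℕ) : Fmap X j (LinearMap.id : N →ₗ[R] N) = LinearMap.id := by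
  ext e
  simp [Fmap_apply]

lemma Fmap_add (j : ℕ) (f g : N →ₗ[R] N') : Fmap X j (f + g) = Fmap X j f + Fmap X j g := by
  ext e
  simp [Fmap_apply, ModuleCat.ofHom_add, Abelian.Ext.mk₀_add]

lemma Fmap_zero (j : ℕ) : Fmap X j (0 : N →ₗ[R] N') = 0 := by
  have := Fmap_add X j (0 : N →ₗ[R] N') 0
  simpa using this

lemma Fmap_sum (j : ℕ) {ι : Type*} (s : Finset ι) (f : ι → N →ₗ[R] N') :
    Fmap X j (∑ i ∈ s, f i) = ∑ i ∈ s, Fmap X j (f i) := by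
  classical
  induction s using Finset.induction_on with
  | empty => simp [Fmap_zero]
  | insert a s ha ih => rw [Finset.sum_insert ha, Finset.sum_insert ha, Fmap_add, ih]

lemma Fmap_smul (j : ℕ) (r : R) (f : N →ₗ[R] N') : Fmap X j (r • f) = r • Fmap X j f := by
  ext e
  have : ModuleCat.ofHom (r • f) = r • ModuleCat.ofHom f := rfl
  simp [Fmap_apply, this, Abelian.Ext.mk₀_smul]

lemma F_smul_eq_zero (𝔞 : Ideal R) (j : ℕ) (r : R) (hr : r ∈ 𝔞)
    (e : F (ModuleCat.of R (R ⧸ 𝔞)) j N) : r • e = 0 := by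
  have h : r • 𝟙 (ModuleCat.of R (R ⧸ 𝔞)) = 0 := by
    ext x
    change r • (1 : R ⧸ 𝔞) = 0
    rw [Algebra.smul_def, mul_one]
    exact Ideal.Quotient.eq_zero_iff_mem.2 hr
  calc r • e = r • (Abelian.Ext.mk₀ (𝟙 _)).comp e (zero_add j) := by simp
    _ = 0 := by rw [← Abelian.Ext.smul_comp, ← Abelian.Ext.mk₀_smul, h]; simp

lemma F_finite_of_equiv (j : ℕ) (e : N ≃ₗ[R] N') (h : Module.Finite R (F X j N)) :
    Module.Finite R (F X j N') := by
  refine Module.Finite.of_surjective (Fmap X j e.toLinearMap) ?_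
  intro y
  refine ⟨Fmap X j e.symm.toLinearMap y, ?_⟩
  rw [← LinearMap.comp_apply, ← Fmap_comp]
  simp [Fmap_id]

/-- finiteness along a map with f.g. kernel -/
lemma finite_of_ker {V W : Type} [AddCommGroup V] [Module R V] [AddCommGroup W] [Module R W]
    (f : V →ₗ[R] W) (hk : (LinearMap.ker f).FG) (hW : Module.Finite R W) : Module.Finite R V := by
  have : IsNoetherian R W := inferInstance
  refine ⟨Submodule.fg_of_fg_map_of_fg_inf_ker f ?_ ?_⟩
  · exact IsNoetherian.noetherian _
  · simpa using hk

lemma fg_of_le' {V : Type} [AddCommGroup V] [Module R V] {S T : Submodule R V} (h : S ≤ T)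
    (hT : T.FG) : S.FG := by
  have : Module.Finite R T := Module.Finite.iff_fg.2 hT
  have : IsNoetherian R T := inferInstance
  have := Submodule.FG.map T.subtype (IsNoetherian.noetherian (S.comap T.subtype))
  rwa [Submodule.map_comap_subtype, inf_eq_right.2 h] at this

lemma ker_comp_fg {V W U : Type} [AddCommGroup V] [Module R V] [AddCommGroup W] [Module R W]
    [AddCommGroup U] [Module R U]
    (f : V →ₗ[R] W) (g : W →ₗ[R] U) (hf : (LinearMap.ker f).FG) (hg : (LinearMap.ker g).FG) :
    (LinearMap.ker (g ∘ₗ f)).FG := by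
  refine Submodule.fg_of_fg_map_of_fg_inf_ker f ?_ ?_
  · have h : (LinearMap.ker (g ∘ₗ f)).map f ≤ LinearMap.ker g := by
      rintro _ ⟨x, hx, rfl⟩
      simpa using hx
    exact fg_of_le' h hg
  · rwa [inf_eq_right.2]
    intro x hx
    simp only [LinearMap.mem_ker, LinearMap.comp_apply] at hx ⊢
    rw [hx, map_zero]

section ses
variable (f : N →ₗ[R] N') (g : N' →ₗ[R] N'') (hf : Function.Injective f)
  (hg : Function.Surjective g) (hfg : Function.Exact f g)

include hf hg hfg

lemma ses_short : (ModuleCat.shortComplexOfCompEqZero f g hfg.linearMap_comp_eq_zero).ShortExact :=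
  ModuleCat.shortComplex_shortExact _ hfg hf hg

lemma ker_Fmap_g (j : ℕ) (h : Module.Finite R (F X j N)) : (LinearMap.ker (Fmap X j g)).FG := by
  have hs := ses_short f g hf hg hfg
  have : LinearMap.ker (Fmap X j g) ≤ LinearMap.range (Fmap X j f) := by
    intro e he
    exact Abelian.Ext.covariant_sequence_exact₂ X hs e he
  exact fg_of_le' this (Module.Finite.iff_fg.1 inferInstance)

lemma ker_Fmap_f (j : ℕ) (h : ∀ j', j' + 1 = j → Module.Finite R (F X j' N'')) :
    (LinearMap.ker (Fmap X j f)).FG := by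
  have hs := ses_short f g hf hg hfg
  cases j with
  | zero =>
    have : Mono (ModuleCat.ofHom f) := (ModuleCat.mono_iff_injective _).2 hf
    have h0 : Function.Injective (Fmap X 0 f) :=
      Abelian.Ext.postcomp_mk₀_injective_of_mono X (ModuleCat.ofHom f)
    rw [LinearMap.ker_eq_bot.2 h0]
    exact Submodule.fg_bot
  | succ q =>
    have := h q rfl
    let δ : F X q N'' →ₗ[R] F X (q+1) N := hs.extClass.postcompOfLinear R X rfl
    have hle : LinearMap.ker (Fmap X (q+1) f) ≤ LinearMap.range δ := by
      intro e he
      exact Abelian.Ext.covariant_sequence_exact₁ X hs e he rfl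
    exact fg_of_le' hle (Module.Finite.iff_fg.1 inferInstance)

end ses

lemma F_finite_hom_free (M : Type) [AddCommGroup M] [Module R M] (j r : ℕ)
    (h : Module.Finite R (F X j M)) : Module.Finite R (F X j ((Fin r → R) →ₗ[R] M)) := by
  let ev (s : Fin r) : ((Fin r → R) →ₗ[R] M) →ₗ[R] M := LinearMap.applyₗ (Pi.single s 1)
  let inc (s : Fin r) : M →ₗ[R] ((Fin r → R) →ₗ[R] M) :=
    LinearMap.smulRightₗ (LinearMap.proj s)
  have hsum : ∑ s, inc s ∘ₗ ev s = LinearMap.id := by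
    ext φ s
    simp [inc, ev, Pi.single_apply]
  let Φ : F X j ((Fin r → R) →ₗ[R] M) →ₗ[R] (Fin r → F X j M) :=
    LinearMap.pi fun s => Fmap X j (ev s)
  have hΦ : LinearMap.ker Φ = ⊥ := by
    rw [LinearMap.ker_eq_bot']
    intro e he
    have : Fmap X j (∑ s, inc s ∘ₗ ev s) e = e := by rw [hsum, Fmap_id]; rfl
    rw [← this, Fmap_sum, LinearMap.sum_apply]
    refine Finset.sum_eq_zero fun s _ => ?_
    rw [Fmap_comp, LinearMap.comp_apply]
    have : Fmap X j (ev s) e = 0 := congrFun he s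
    rw [this, map_zero]
  exact finite_of_ker Φ (by rw [hΦ]; exact Submodule.fg_bot) inferInstance

section syz

-- data of a presentation `0 → Ω → P → L → 0`
variable {M : Type} [AddCommGroup M] [Module R M]
  {Ω P L : Type} [AddCommGroup Ω] [Module R Ω] [AddCommGroup P] [Module R P] [AddCommGroup L]
  [Module R L] (ι : Ω →ₗ[R] P) (π : P →ₗ[R] L) (hι : Function.Injective ι)
  (hπ : Function.Surjective π) (hιπ : Function.Exact ι π)

variable (M) in
def dlt : (Ω →ₗ[R] M) →ₗ[R] F (ModuleCat.of R L) 1 M :=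
  ((ses_short ι π hι hπ hιπ).extClass.precompOfLinear R (ModuleCat.of R M) (add_zero 1)) ∘ₗ
    (Abelian.Ext.linearEquiv₀ (R := R)).symm.toLinearMap ∘ₗ
    (ModuleCat.homLinearEquiv (S := R) (M := ModuleCat.of R Ω) (N := ModuleCat.of R M)).symm.toLinearMap

lemma dlt_apply (φ : Ω →ₗ[R] M) : dlt M ι π hι hπ hιπ φ =
    (ses_short ι π hι hπ hιπ).extClass.comp (Abelian.Ext.mk₀ (ModuleCat.ofHom φ)) (add_zero 1) := rfl

lemma dlt_eq_zero_iff (φ : Ω →ₗ[R] M) : dlt M ι π hι hπ hιπ φ = 0 ↔ ∃ ψ : P →ₗ[R] M, ψ ∘ₗ ι = φ := by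
  rw [dlt_apply]
  constructor
  · intro h
    obtain ⟨x, hx⟩ := Abelian.Ext.contravariant_sequence_exact₁ (ses_short ι π hι hπ hιπ) _ _ _ h
    obtain ⟨y, rfl⟩ := (Abelian.Ext.mk₀_bijective _ _).2 x
    rw [Abelian.Ext.mk₀_comp_mk₀] at hx
    have := (Abelian.Ext.mk₀_bijective _ _).1 hx
    exact ⟨y.hom, by simpa using congrArg ModuleCat.Hom.hom this⟩
  · rintro ⟨ψ, rfl⟩
    rw [ModuleCat.ofHom_comp, ← Abelian.Ext.mk₀_comp_mk₀]
    exact (ses_short ι π hι hπ hιπ).extClass_comp_assoc _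

lemma dlt_surj [Module.Projective R P] : Function.Surjective (dlt M ι π hι hπ hιπ) := by
  intro e
  have : Projective (ModuleCat.of R P) := inferInstance
  have : Projective (ModuleCat.shortComplexOfCompEqZero ι π hιπ.linearMap_comp_eq_zero).X₂ := this
  obtain ⟨x, hx⟩ := precomp_extClass_surjective_of_projective_X₂ (ModuleCat.of R M)
    (ses_short ι π hι hπ hιπ) 0 e
  obtain ⟨y, rfl⟩ := (Abelian.Ext.mk₀_bijective _ _).2 x
  exact ⟨y.hom, hx⟩

def shiftEquiv [Module.Projective R P] (i : ℕ) :
    F (ModuleCat.of R Ω) (i+1) M ≃ₗ[R] F (ModuleCat.of R L) (i+2) M :=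
  LinearEquiv.ofBijective
    ((ses_short ι π hι hπ hιπ).extClass.precompOfLinear R (ModuleCat.of R M) (show 1 + (i + 1) = i + 2 by omega)) (by
    have : Projective (ModuleCat.of R P) := inferInstance
    have : Projective (ModuleCat.shortComplexOfCompEqZero ι π hιπ.linearMap_comp_eq_zero).X₂ := this
    constructor
    · rw [← LinearMap.ker_eq_bot, LinearMap.ker_eq_bot']
      intro e he
      obtain ⟨x, hx⟩ := Abelian.Ext.contravariant_sequence_exact₁ (ses_short ι π hι hπ hιπ) _ e
        (show 1 + (i + 1) = i + 2 by omega) he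
      rw [← hx, Abelian.Ext.eq_zero_of_projective x, Abelian.Ext.comp_zero]
    · exact precomp_extClass_surjective_of_projective_X₂ (ModuleCat.of R M)
        (ses_short ι π hι hπ hιπ) (i+1))

/-- `B`, the image of `Hom(P, M)` in `Hom(Ω, M)` -/
abbrev BB (M : Type) [AddCommGroup M] [Module R M] (ι : Ω →ₗ[R] P) (π : P →ₗ[R] L)
  (hι : Function.Injective ι)
  (hπ : Function.Surjective π) (hιπ : Function.Exact ι π) := LinearMap.ker (dlt M ι π hι hπ hιπ)

variable (M) in
def toBB : (P →ₗ[R] M) →ₗ[R] BB M ι π hι hπ hιπ :=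
  (LinearMap.lcomp R M ι).codRestrict _ (fun ψ => (dlt_eq_zero_iff ι π hι hπ hιπ _).2 ⟨ψ, rfl⟩)

lemma toBB_surj : Function.Surjective (toBB M ι π hι hπ hιπ) := by
  rintro ⟨φ, hφ⟩
  obtain ⟨ψ, h⟩ := (dlt_eq_zero_iff ι π hι hπ hιπ _).1 hφ
  exact ⟨ψ, Subtype.ext h⟩

lemma lcomp_inj (π : P →ₗ[R] L) (hπ : Function.Surjective π) : Function.Injective (LinearMap.lcomp R M π) := by
  intro a b h
  ext x
  obtain ⟨y, rfl⟩ := hπ x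
  exact LinearMap.congr_fun h y

lemma lcomp_exact : Function.Exact (LinearMap.lcomp R M π) (toBB M ι π hι hπ hιπ) := by
  intro ψ
  constructor
  · intro h
    have h' : ψ ∘ₗ ι = 0 := congrArg Subtype.val h
    have hk : LinearMap.ker π ≤ LinearMap.ker ψ := by
      intro x hx
      obtain ⟨y, rfl⟩ := (hιπ x).1 hx
      exact LinearMap.congr_fun h' y
    refine ⟨((LinearMap.ker π).liftQ ψ hk) ∘ₗ (π.quotKerEquivOfSurjective hπ).symm.toLinearMap, ?_⟩
    ext x
    have : (π.quotKerEquivOfSurjective hπ).symm (π x) = Submodule.Quotient.mk x := by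
      rw [LinearEquiv.symm_apply_eq]; rfl
    simp [this]
  · rintro ⟨φ, rfl⟩
    apply Subtype.ext
    ext x
    change φ (π (ι x)) = 0
    rw [(hιπ _).2 ⟨x, rfl⟩, map_zero]

lemma exists_pres (L : Type) [AddCommGroup L] [Module R L] [Module.Finite R L] :
    ∃ (r : ℕ) (π : (Fin r → R) →ₗ[R] L), Function.Surjective π :=
  Module.Finite.exists_fin' R L

lemma ker_exact {V W : Type} [AddCommGroup V] [Module R V] [AddCommGroup W] [Module R W]
    (f : V →ₗ[R] W) : Function.Exact (LinearMap.ker f).subtype f := by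
  intro x; simp

end syz

lemma key (M : Type) [AddCommGroup M] [Module R M] (k : ℕ)
    (hM : ∀ j < k, Module.Finite R (F X j M)) (j : ℕ) (hj : j < k) :
    ∀ (Ω P L : Type) [AddCommGroup Ω] [Module R Ω] [AddCommGroup P] [Module R P] [AddCommGroup L]
      [Module R L] [Module.Finite R P] [Module.Projective R P] (ι : Ω →ₗ[R] P) (π : P →ₗ[R] L)
      (hι : Function.Injective ι) (hπ : Function.Surjective π) (hιπ : Function.Exact ι π)
      (_ : ∀ i j', i + 1 + j' ≤ j →
        Module.Finite R (F X j' (F (ModuleCat.of R L) (i+1) M))),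
      Module.Finite R (F X j (BB M ι π hι hπ hιπ)) := by
  induction j with
  | zero =>
    intro Ω P L _ _ _ _ _ _ _ _ ι π hι hπ hιπ H
    have : Module.Finite R Ω := Module.Finite.of_injective ι hι
    obtain ⟨r, π', hπ'⟩ := exists_pres (R := R) Ω
    have h1 : Module.Finite R (F X 0 (Ω →ₗ[R] M)) := by
      refine finite_of_ker (Fmap X 0 (LinearMap.lcomp R M π'))
        (ker_Fmap_f X _ _ (lcomp_inj π' hπ')
          (toBB_surj (LinearMap.ker π').subtype π' Subtype.val_injective hπ' (ker_exact π'))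
          (lcomp_exact _ _ _ _ _) 0 (by simp)) (F_finite_hom_free X M 0 r (hM 0 hj))
    exact finite_of_ker _ (ker_Fmap_f X _ _ (Submodule.subtype_injective _)
      (dlt_surj ι π hι hπ hιπ) (ker_exact _) 0 (by simp)) h1
  | succ j ih =>
    intro Ω P L _ _ _ _ _ _ _ _ ι π hι hπ hιπ H
    have : Module.Finite R Ω := Module.Finite.of_injective ι hι
    obtain ⟨r, π', hπ'⟩ := exists_pres (R := R) Ω
    have h1 : Module.Finite R (F X (j+1) (Ω →ₗ[R] M)) := by
      refine finite_of_ker (Fmap X (j+1) (LinearMap.lcomp R M π'))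
        (ker_Fmap_f X _ _ (lcomp_inj π' hπ')
          (toBB_surj (LinearMap.ker π').subtype π' Subtype.val_injective hπ' (ker_exact π'))
          (lcomp_exact _ _ _ _ _) (j+1) ?_) (F_finite_hom_free X M (j+1) r (hM _ hj))
      intro j' hj'
      obtain rfl : j' = j := by omega
      refine ih (by omega) _ _ _ _ _ _ _ _ ?_
      intro i j'' hij
      exact F_finite_of_equiv X _ (shiftEquiv ι π hι hπ hιπ i).symm (H (i+1) j'' (by omega))
    refine finite_of_ker _ (ker_Fmap_f X _ _ (Submodule.subtype_injective _)
      (dlt_surj ι π hι hπ hιπ) (ker_exact _) (j+1) ?_) h1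
    intro j' hj'
    exact H 0 j' (by omega)

theorem main_thm (𝔟 𝔞 : Ideal R) (h𝔟𝔞 : 𝔟 ≤ 𝔞)
    (M : Type) [AddCommGroup M] [Module R M] (n : ℕ)
    (H : ∀ i ≤ n, ∀ j ≤ n, Module.Finite R
      (F (ModuleCat.of R (R ⧸ 𝔞)) j (F (ModuleCat.of R (R ⧸ 𝔟)) i M))) :
    ∀ k ≤ n, Module.Finite R (F (ModuleCat.of R (R ⧸ 𝔞)) k M) := by
  intro k
  induction k using Nat.strong_induction_on with
  | _ k IH =>
  intro hk
  set X := ModuleCat.of R (R ⧸ 𝔞) with hX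
  have hM : ∀ j < k, Module.Finite R (F X j M) := fun j hj => IH j hj (by omega)
  let ι : 𝔟 →ₗ[R] R := Submodule.subtype 𝔟
  let π : R →ₗ[R] (R ⧸ 𝔟) := Submodule.mkQ 𝔟
  have hι : Function.Injective ι := Subtype.val_injective
  have hπ : Function.Surjective π := Submodule.mkQ_surjective 𝔟
  have hιπ : Function.Exact ι π := LinearMap.exact_subtype_mkQ 𝔟
  obtain ⟨r, π', hπ'⟩ := exists_pres (R := R) 𝔟
  -- the three maps
  have k1 : (LinearMap.ker (Fmap X k (toBB M ι π hι hπ hιπ))).FG := by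
    refine ker_Fmap_g X _ _ (lcomp_inj π hπ) (toBB_surj ι π hι hπ hιπ) (lcomp_exact _ _ _ _ _) k ?_
    exact F_finite_of_equiv X k ((Abelian.Ext.linearEquiv₀ (R := R)).trans
      ModuleCat.homLinearEquiv) (H 0 (by omega) k hk)
  have k2 : (LinearMap.ker (Fmap X k (BB M ι π hι hπ hιπ).subtype)).FG := by
    refine ker_Fmap_f X _ _ (Submodule.subtype_injective _)
      (dlt_surj ι π hι hπ hιπ) (ker_exact _) k ?_
    intro j' hj'
    exact H 1 (by omega) j' (by omega)
  have k3 : (LinearMap.ker (Fmap X k (LinearMap.lcomp R M π'))).FG := by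
    refine ker_Fmap_f X _ _ (lcomp_inj π' hπ')
          (toBB_surj (LinearMap.ker π').subtype π' Subtype.val_injective hπ' (ker_exact π'))
          (lcomp_exact _ _ _ _ _) k ?_
    intro j' hj'
    refine key X M k hM j' (by omega) _ _ _ _ _ _ _ _ ?_
    intro i j'' hij
    exact F_finite_of_equiv X _ (shiftEquiv ι π hι hπ hιπ i).symm
      (H (i+2) (by omega) j'' (by omega))
  have k4 := ker_comp_fg _ _ (ker_comp_fg _ _ k1 k2) k3
  rw [← Fmap_comp, ← Fmap_comp] at k4
  have hz : Fmap X k (LinearMap.lcomp R M π' ∘ₗ (BB M ι π hι hπ hιπ).subtype ∘ₗ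
      toBB M ι π hι hπ hιπ) = 0 := by
    have hs : LinearMap.lcomp R M π' ∘ₗ (BB M ι π hι hπ hιπ).subtype ∘ₗ toBB M ι π hι hπ hιπ =
        ∑ s : Fin r, ((π' (Pi.single s 1) : R)) •
          LinearMap.lcomp R M (LinearMap.proj s : (Fin r → R) →ₗ[R] R) := by
      apply LinearMap.ext
      intro φ
      apply LinearMap.pi_ext'
      intro t
      apply LinearMap.ext_ring
      change φ (π' (Pi.single t 1) : R) = _
      simp only [LinearMap.sum_apply, LinearMap.smul_apply, LinearMap.comp_apply,
        LinearMap.lcomp_apply, LinearMap.proj_apply, LinearMap.single_apply]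
      rw [Finset.sum_eq_single t]
      · rw [Pi.single_eq_same, ← map_smul, smul_eq_mul, mul_one]
      · intro b _ hb
        rw [Pi.single_eq_of_ne hb, map_zero, smul_zero]
      · simp
    rw [hs, Fmap_sum]
    refine Finset.sum_eq_zero fun s _ => ?_
    ext e
    rw [Fmap_smul, LinearMap.smul_apply]
    exact F_smul_eq_zero 𝔞 k _ (h𝔟𝔞 (π' (Pi.single s 1)).2) _
  rw [hz, LinearMap.ker_zero] at k4
  exact F_finite_of_equiv X k (LinearMap.ringLmapEquivSelf R R M) ⟨k4⟩

end main

/-- If `𝔟 ⊆ 𝔞` and `Ext_A^j(A/𝔞, Ext_A^i(A/𝔟, M))` is finitely generated for all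
`i ≤ n` and `j ≤ n`, then `Ext_A^i(A/𝔞, M)` is finitely generated for all `i ≤ n`. -/
theorem stmt3 [IsNoetherianRing A] (𝔟 𝔞 : Ideal A) (h𝔟𝔞 : 𝔟 ≤ 𝔞)
    (M : Type) [AddCommGroup M] [Module A M] (n : ℕ)
    (H : ∀ i ≤ n, ∀ j ≤ n, Module.Finite A (extQuot 𝔞 (extQuot 𝔟 M i) j)) :
    ∀ i ≤ n, Module.Finite A (extQuot 𝔞 M i) := by
  intro i hi
  have key' := main_thm 𝔟 𝔞 h𝔟𝔞 M n (fun i hi j hj => by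
    have h1 := H i hi j hj
    have h2 : Module.Finite A (F (ModuleCat.of A (A ⧸ 𝔞)) j (extQuot 𝔟 M i)) :=
      Module.Finite.equiv (extBridge (ModuleCat.of A (A ⧸ 𝔞)) (ModuleCat.of A (extQuot 𝔟 M i)) j)
    exact F_finite_of_equiv _ j (extBridge (ModuleCat.of A (A ⧸ 𝔟)) (ModuleCat.of A M) i) h2) i hi
  exact Module.Finite.equiv (extBridge (ModuleCat.of A (A ⧸ 𝔞)) (ModuleCat.of A M) i).symm

end
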